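/- Let (𝒜, α) be a weighted system and suppose λ > 0 satisfies ρ(δ_λ^α(𝒜)) = 1, where ρ denotes the classical joint spectral radius. Then the α-weighted joint spectral radius satisfies ρ(𝒜, α) = λ^{−1}, and λ is the unique positive solution of the equation ρ(δ_λ^α(𝒜)) = 1. -/

import Mathlib

open Filter

attribute [local instance] Matrix.linftyOpNormedRing

/-- The product `A(k)⋯A(1)` associated with the word `w = (i_1, …, i_k)`. -/
noncomputable def wordProd {d m : ℕ} (A : Fin m → Matrix (Fin d) (Fin d) ℝ)
    (w : List (Fin m)) : Matrix (Fin d) (Fin d) ℝ :=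
  ((w.map A).reverse).prod

/-- The total weight `α(k)+⋯+α(1)` of the word `w = (i_1, …, i_k)`. -/
def wordWeight {m : ℕ} (α : Fin m → ℝ) (w : List (Fin m)) : ℝ :=
  (w.map α).sum

/-- `ρ_k`: the maximum of `‖A(k)⋯A(1)‖^(1/(α(k)+⋯+α(1)))` over products of length `k`. -/
noncomputable def rhoSeq {d m : ℕ} (A : Fin m → Matrix (Fin d) (Fin d) ℝ)
    (α : Fin m → ℝ) (k : ℕ) : ℝ :=
  sSup {r : ℝ | ∃ w : List (Fin m), w.length = k ∧
    r = ‖wordProd A w‖ ^ (1 / wordWeight α w)}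

/-- The `α`-weighted joint spectral radius `ρ(𝒜, α) = limsup_{k→∞} ρ_k`. -/
noncomputable def wjsr {d m : ℕ} (A : Fin m → Matrix (Fin d) (Fin d) ℝ)
    (α : Fin m → ℝ) : ℝ :=
  limsup (rhoSeq A α) atTop

theorem mul_length_le_wordWeight {m : ℕ} {α : Fin m → ℝ} {a : ℝ} (ha : ∀ i, a ≤ α i)
    (w : List (Fin m)) : a * w.length ≤ wordWeight α w := by
  induction w with
  | nil => simp [wordWeight]
  | cons i w ih =>
    simp only [wordWeight, List.map_cons, List.sum_cons, List.length_cons] at ih ⊢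
    push_cast
    linarith [ha i]

theorem wordWeight_one {m : ℕ} (w : List (Fin m)) :
    wordWeight (fun _ => 1) w = w.length := by
  simp [wordWeight]

theorem wordProd_dilation {d m : ℕ} (A : Fin m → Matrix (Fin d) (Fin d) ℝ)
    (α : Fin m → ℝ) {μ : ℝ} (hμ : 0 < μ) (w : List (Fin m)) :
    wordProd (fun i => (μ ^ α i) • A i) w = (μ ^ wordWeight α w) • wordProd A w := by
  induction w with
  | nil => simp [wordProd, wordWeight]
  | cons i w ih =>
    simp only [wordProd, wordWeight, List.map_cons, List.reverse_cons, List.prod_append,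
      List.prod_singleton, List.sum_cons] at ih ⊢
    rw [ih, Real.rpow_add hμ, smul_mul_smul_comm, mul_comm]

theorem norm_wordProd_dilation {d m : ℕ} (A : Fin m → Matrix (Fin d) (Fin d) ℝ)
    (α : Fin m → ℝ) {μ : ℝ} (hμ : 0 < μ) (w : List (Fin m)) :
    ‖wordProd (fun i => (μ ^ α i) • A i) w‖ = μ ^ wordWeight α w * ‖wordProd A w‖ := by
  let _ : NormedSpace ℝ (Matrix (Fin d) (Fin d) ℝ) := Matrix.linftyOpNormedSpace
  rw [wordProd_dilation A α hμ]
  refine (norm_smul (μ ^ wordWeight α w) (wordProd A w)).trans ?_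
  rw [Real.norm_of_nonneg (Real.rpow_nonneg hμ.le _)]

theorem norm_wordProd_le {d m : ℕ} (A : Fin m → Matrix (Fin d) (Fin d) ℝ) {C : ℝ}
    (hC : ∀ i, ‖A i‖ ≤ C) {w : List (Fin m)} (hw : w ≠ []) :
    ‖wordProd A w‖ ≤ C ^ w.length := by
  induction w with
  | nil => exact absurd rfl hw
  | cons i w ih =>
    rcases eq_or_ne w [] with rfl | hne
    · simpa [wordProd] using hC i
    · have hcons : wordProd A (i :: w) = wordProd A w * A i := by simp [wordProd]
      rw [hcons, List.length_cons, pow_succ]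
      exact (norm_mul_le _ _).trans (mul_le_mul (ih hne) (hC i) (norm_nonneg _)
        ((norm_nonneg _).trans (ih hne)))

theorem finite_rhoSeq_set {d m : ℕ} (A : Fin m → Matrix (Fin d) (Fin d) ℝ)
    (α : Fin m → ℝ) (k : ℕ) :
    {r : ℝ | ∃ w : List (Fin m), w.length = k ∧
      r = ‖wordProd A w‖ ^ (1 / wordWeight α w)}.Finite := by
  refine ((List.finite_length_eq (Fin m) k).image
    fun w => ‖wordProd A w‖ ^ (1 / wordWeight α w)).subset ?_
  rintro r ⟨w, hw, rfl⟩
  exact ⟨w, hw, rfl⟩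

theorem le_rhoSeq {d m : ℕ} (A : Fin m → Matrix (Fin d) (Fin d) ℝ)
    (α : Fin m → ℝ) (w : List (Fin m)) :
    ‖wordProd A w‖ ^ (1 / wordWeight α w) ≤ rhoSeq A α w.length :=
  le_csSup (finite_rhoSeq_set A α _).bddAbove ⟨w, rfl, rfl⟩

theorem exists_eq_rhoSeq {d m : ℕ} (hm : 0 < m) (A : Fin m → Matrix (Fin d) (Fin d) ℝ)
    (α : Fin m → ℝ) (k : ℕ) :
    ∃ w : List (Fin m), w.length = k ∧
      rhoSeq A α k = ‖wordProd A w‖ ^ (1 / wordWeight α w) := by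
  have hne : {r : ℝ | ∃ w : List (Fin m), w.length = k ∧
      r = ‖wordProd A w‖ ^ (1 / wordWeight α w)}.Nonempty :=
    ⟨_, List.replicate k ⟨0, hm⟩, List.length_replicate, rfl⟩
  exact hne.csSup_mem (finite_rhoSeq_set A α k)

theorem rhoSeq_nonneg {d m : ℕ} (A : Fin m → Matrix (Fin d) (Fin d) ℝ)
    (α : Fin m → ℝ) (k : ℕ) : 0 ≤ rhoSeq A α k := by
  refine Real.sSup_nonneg ?_
  rintro r ⟨w, -, rfl⟩
  positivity

theorem isBoundedUnder_le_rhoSeq {d m : ℕ} (hm : 0 < m)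
    (A : Fin m → Matrix (Fin d) (Fin d) ℝ) {α : Fin m → ℝ} {a : ℝ} (ha₀ : 0 < a)
    (ha : ∀ i, a ≤ α i) : IsBoundedUnder (· ≤ ·) atTop (rhoSeq A α) := by
  obtain ⟨C, hC⟩ := (Set.finite_range fun i => ‖A i‖).bddAbove
  have hC' : ∀ i, ‖A i‖ ≤ max C 1 := fun i => (hC ⟨i, rfl⟩).trans (le_max_left _ _)
  have h1 : 1 ≤ max C 1 := le_max_right _ _
  refine isBoundedUnder_of_eventually_le (a := (max C 1) ^ (1 / a)) ?_
  filter_upwards [eventually_gt_atTop 0] with k hk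
  obtain ⟨w, rfl, hr⟩ := exists_eq_rhoSeq hm A α k
  have hk' : (0 : ℝ) < w.length := by exact_mod_cast hk
  have hW := mul_length_le_wordWeight ha w
  have hW₀ : 0 < wordWeight α w := (mul_pos ha₀ hk').trans_le hW
  rw [hr]
  calc ‖wordProd A w‖ ^ (1 / wordWeight α w)
      ≤ ((max C 1) ^ w.length) ^ (1 / wordWeight α w) :=
        Real.rpow_le_rpow (norm_nonneg _) (norm_wordProd_le A hC' (List.length_pos_iff.1 hk))
          (by positivity)
    _ = (max C 1) ^ (w.length * (1 / wordWeight α w)) := by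
        rw [← Real.rpow_natCast, ← Real.rpow_mul (by positivity)]
    _ ≤ (max C 1) ^ (1 / a) := by
        refine Real.rpow_le_rpow_of_exponent_le h1 ?_
        rw [mul_one_div, div_le_div_iff₀ hW₀ ha₀]
        linarith

theorem isCoboundedUnder_le_rhoSeq {d m : ℕ} (A : Fin m → Matrix (Fin d) (Fin d) ℝ)
    (α : Fin m → ℝ) : IsCoboundedUnder (· ≤ ·) atTop (rhoSeq A α) :=
  (isBoundedUnder_of ⟨0, rhoSeq_nonneg A α⟩ : IsBoundedUnder (· ≥ ·) atTop _).isCoboundedUnder_le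

/-- The quantities entering the two joint spectral radii are powers of each other. -/
theorem norm_wordProd_dilation_rpow {d m : ℕ} (A : Fin m → Matrix (Fin d) (Fin d) ℝ)
    {α : Fin m → ℝ} {μ : ℝ} (hμ : 0 < μ) {w : List (Fin m)} (hw : 0 < wordWeight α w) :
    ‖wordProd (fun i => (μ ^ α i) • A i) w‖ ^ (1 / wordWeight (fun _ => 1) w) =
      (μ * ‖wordProd A w‖ ^ (1 / wordWeight α w)) ^ (wordWeight α w / w.length) := by
  have h : μ ^ wordWeight α w * ‖wordProd A w‖ =
      (μ * ‖wordProd A w‖ ^ (1 / wordWeight α w)) ^ wordWeight α w := by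
    rw [Real.mul_rpow hμ.le (by positivity), ← Real.rpow_mul (norm_nonneg _),
      one_div_mul_cancel hw.ne', Real.rpow_one]
  rw [norm_wordProd_dilation A α hμ, wordWeight_one, h, ← Real.rpow_mul (by positivity),
    mul_one_div]

theorem rhoSeq_dilation_le {d m : ℕ} (hm : 0 < m) (A : Fin m → Matrix (Fin d) (Fin d) ℝ)
    {α : Fin m → ℝ} {a : ℝ} (ha₀ : 0 < a) (ha : ∀ i, a ≤ α i) {μ c : ℝ} (hμ : 0 < μ)
    (hc₀ : 0 < c) (hc : c ≤ 1) {k : ℕ} (hk : 0 < k) (h : μ * rhoSeq A α k ≤ c) :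
    rhoSeq (fun i => (μ ^ α i) • A i) (fun _ => 1) k ≤ c ^ a := by
  obtain ⟨w, rfl, hr⟩ := exists_eq_rhoSeq hm (fun i => (μ ^ α i) • A i) (fun _ => 1) k
  have hk' : (0 : ℝ) < w.length := by exact_mod_cast hk
  have hW := mul_length_le_wordWeight ha w
  have hW₀ : 0 < wordWeight α w := (mul_pos ha₀ hk').trans_le hW
  rw [hr, norm_wordProd_dilation_rpow A hμ hW₀]
  calc (μ * ‖wordProd A w‖ ^ (1 / wordWeight α w)) ^ (wordWeight α w / w.length)
      ≤ c ^ (wordWeight α w / w.length) :=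
        Real.rpow_le_rpow (by positivity)
          ((mul_le_mul_of_nonneg_left (le_rhoSeq A α w) hμ.le).trans h) (by positivity)
    _ ≤ c ^ a := Real.rpow_le_rpow_of_exponent_ge hc₀ hc ((le_div_iff₀ hk').2 hW)

theorem le_rhoSeq_dilation {d m : ℕ} (hm : 0 < m) (A : Fin m → Matrix (Fin d) (Fin d) ℝ)
    {α : Fin m → ℝ} {a : ℝ} (ha₀ : 0 < a) (ha : ∀ i, a ≤ α i) {μ c : ℝ} (hμ : 0 < μ)
    (hc : 1 ≤ c) {k : ℕ} (hk : 0 < k) (h : c ≤ μ * rhoSeq A α k) :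
    c ^ a ≤ rhoSeq (fun i => (μ ^ α i) • A i) (fun _ => 1) k := by
  obtain ⟨w, rfl, hr⟩ := exists_eq_rhoSeq hm A α k
  have hk' : (0 : ℝ) < w.length := by exact_mod_cast hk
  have hW := mul_length_le_wordWeight ha w
  have hW₀ : 0 < wordWeight α w := (mul_pos ha₀ hk').trans_le hW
  refine le_trans ?_ (le_rhoSeq _ _ w)
  rw [norm_wordProd_dilation_rpow A hμ hW₀, ← hr]
  exact (Real.rpow_le_rpow_of_exponent_le hc ((le_div_iff₀ hk').2 hW)).trans
    (Real.rpow_le_rpow (by positivity) h (by positivity))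

theorem wjsr_eq_inv_of_dilation {d m : ℕ} (hm : 0 < m)
    (A : Fin m → Matrix (Fin d) (Fin d) ℝ)
    (α : Fin m → ℝ) (hα : ∀ i, 0 < α i) {μ : ℝ} (hμ : 0 < μ)
    (h : wjsr (fun i => (μ ^ α i) • A i) (fun _ => 1) = 1) :
    wjsr A α = μ⁻¹ := by
  have : Nonempty (Fin m) := ⟨⟨0, hm⟩⟩
  obtain ⟨i₀, ha⟩ := Finite.exists_min α
  have ha₀ := hα i₀
  refine le_antisymm (le_of_not_gt fun hlt => ?_) (le_of_not_gt fun hlt => ?_)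
  · obtain ⟨c, hc, hc'⟩ := exists_between hlt
    have h1 : 1 < μ * c := by rwa [inv_lt_iff_one_lt_mul₀' hμ] at hc
    have hfreq : ∃ᶠ k in atTop, (μ * c) ^ α i₀ ≤
        rhoSeq (fun i => (μ ^ α i) • A i) (fun _ => 1) k :=
      ((frequently_lt_of_lt_limsup (isCoboundedUnder_le_rhoSeq A α) hc').and_eventually
        (eventually_gt_atTop 0)).mono fun k hk =>
          le_rhoSeq_dilation hm A ha₀ ha hμ h1.le hk.2 (mul_le_mul_of_nonneg_left hk.1.le hμ.le)
    have hle : (μ * c) ^ α i₀ ≤ wjsr (fun i => (μ ^ α i) • A i) (fun _ => 1) :=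
      le_limsup_of_frequently_le hfreq
        (isBoundedUnder_le_rhoSeq hm _ one_pos fun _ => le_rfl)
    linarith [Real.one_lt_rpow h1 ha₀]
  · obtain ⟨c, hc, hc'⟩ := exists_between (max_lt hlt (inv_pos.2 hμ))
    have hc₀ : 0 < c := (le_max_right _ _).trans_lt hc
    have h1 : μ * c < 1 := by
      simpa [hμ.ne'] using mul_lt_mul_of_pos_left hc' hμ
    have hev : ∀ᶠ k in atTop, rhoSeq (fun i => (μ ^ α i) • A i) (fun _ => 1) k ≤
        (μ * c) ^ α i₀ := by
      filter_upwards [eventually_lt_of_limsup_lt ((le_max_left _ _).trans_lt hc)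
        (isBoundedUnder_le_rhoSeq hm A ha₀ ha), eventually_gt_atTop 0] with k hk hk₀
      exact rhoSeq_dilation_le hm A ha₀ ha hμ (mul_pos hμ hc₀) h1.le hk₀
        (mul_le_mul_of_nonneg_left hk.le hμ.le)
    have hle : wjsr (fun i => (μ ^ α i) • A i) (fun _ => 1) ≤ (μ * c) ^ α i₀ :=
      limsup_le_of_le (isCoboundedUnder_le_rhoSeq _ _) hev
    linarith [Real.rpow_lt_one (mul_pos hμ hc₀).le h1 ha₀]

/-- **Theorem 2.7.** If `λ > 0` satisfies `ρ(δ_λ^α(𝒜)) = 1` (classical joint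
spectral radius of the dilated family), then `ρ(𝒜, α) = λ⁻¹`, and `λ` is the
unique positive solution of this equation. -/
theorem wjsr_eq_inv_of_dilation_jsr_eq_one {d m : ℕ} (hm : 0 < m)
    (A : Fin m → Matrix (Fin d) (Fin d) ℝ)
    (α : Fin m → ℝ) (hα : ∀ i, 0 < α i) (lam : ℝ) (hlam : 0 < lam)
    (h : wjsr (fun i => (lam ^ α i) • A i) (fun _ => 1) = 1) :
    wjsr A α = lam⁻¹ ∧
      ∀ μ : ℝ, 0 < μ → wjsr (fun i => (μ ^ α i) • A i) (fun _ => 1) = 1 → μ = lam := by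
  have hinv := wjsr_eq_inv_of_dilation hm A α hα hlam h
  exact ⟨hinv, fun μ hμ h' =>
    inv_injective ((wjsr_eq_inv_of_dilation hm A α hα hμ h').symm.trans hinv)⟩
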